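/- Let ε > 0, τ > 0, and A ≥ 1/16. Let φ⁺, φ, φ⁻ be periodic grid functions on the m×m grid with spacing h = L/m having equal averages, and suppose they satisfy the scheme (3/2·φ⁺ − 2·φ + 1/2·φ⁻)/τ = Δ_{h,(4)} ( (φ⁺)³ − 2φ + φ⁻ − ε² Δ_{h,(4)} φ⁺ − A τ Δ_{h,(4)}(φ⁺ − φ) ), where (φ⁺)³ is the pointwise cube. Let ψ⁺ and ψ be periodic grid functions with zero average such that −Δ_{h,(4)} ψ⁺ = φ⁺ − φ and −Δ_{h,(4)} ψ = φ − φ⁻. Then E_h(φ⁺) + (1/(4τ))·(φ⁺ − φ, ψ⁺)₂ + (1/2)·‖φ⁺ − φ‖₂² ≤ E_h(φ) + (1/(4τ))·(φ − φ⁻, ψ)₂ + (1/2)·‖φ − φ⁻‖₂². -/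

import Mathlib

open Finset

/-- The discrete inner product `(φ,ψ)₂ = h² ∑_{i,j} φ_{i,j} ψ_{i,j}` on the periodic grid. -/
noncomputable def gridInner (m : ℕ) [NeZero m] (h : ℝ)
    (φ ψ : ZMod m → ZMod m → ℝ) : ℝ :=
  h ^ 2 * ∑ i : ZMod m, ∑ j : ZMod m, φ i j * ψ i j

/-- The average of a periodic grid function: `φ̄ = (1/m²) ∑_{i,j} φ_{i,j}`. -/
noncomputable def gridAvg (m : ℕ) [NeZero m] (φ : ZMod m → ZMod m → ℝ) : ℝ :=
  (1 / (m : ℝ) ^ 2) * ∑ i : ZMod m, ∑ j : ZMod m, φ i j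

/-- The long-stencil fourth-order discrete Laplacian `Δ_{h,(4)} = D²_{x,(4)} + D²_{y,(4)}`. -/
noncomputable def lap4 (m : ℕ) (h : ℝ) (φ : ZMod m → ZMod m → ℝ) :
    ZMod m → ZMod m → ℝ :=
  fun i j =>
    (-φ (i - 2) j + 16 * φ (i - 1) j - 30 * φ i j + 16 * φ (i + 1) j - φ (i + 2) j)
        / (12 * h ^ 2)
      + (-φ i (j - 2) + 16 * φ i (j - 1) - 30 * φ i j + 16 * φ i (j + 1) - φ i (j + 2))
        / (12 * h ^ 2)

/-- The discrete Cahn-Hilliard energy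
`E_h(φ) = (1/4)‖φ‖₄⁴ − (1/2)‖φ‖₂² + (1/4)L² + (ε²/2)(φ, −Δ_{h,(4)} φ)₂`. -/
noncomputable def discEnergy (m : ℕ) [NeZero m] (h L ε : ℝ)
    (φ : ZMod m → ZMod m → ℝ) : ℝ :=
  1 / 4 * (h ^ 2 * ∑ i : ZMod m, ∑ j : ZMod m, |φ i j| ^ 4)
    - 1 / 2 * (h ^ 2 * ∑ i : ZMod m, ∑ j : ZMod m, |φ i j| ^ 2)
    + 1 / 4 * L ^ 2
    + ε ^ 2 / 2 * gridInner m h φ (fun i j => -(lap4 m h φ i j))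

/-- The second-order BDF fourth-order finite difference scheme for the Cahn-Hilliard
equation: `φp` is the new time level computed from `φ, φm`. -/
def chScheme (m : ℕ) (h ε τ A : ℝ) (φ φm φp : ZMod m → ZMod m → ℝ) : Prop :=
  ∀ i j : ZMod m,
    (3 / 2 * φp i j - 2 * φ i j + 1 / 2 * φm i j) / τ
      = lap4 m h
          (fun a b => (φp a b) ^ 3 - 2 * φ a b + φm a b - ε ^ 2 * lap4 m h φp a b
            - A * τ * lap4 m h (fun c d => φp c d - φ c d) a b) i j

/-- Translation invariance of sums over `ZMod m`, for the first factor of a product. -/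
theorem sum_shift_mul (m : ℕ) [NeZero m] (f g : ZMod m → ℝ) (c : ZMod m) :
    ∑ i, f (i + c) * g i = ∑ i, f i * g (i - c) := by
  rw [← Equiv.sum_comp (Equiv.addRight c) (fun i => f i * g (i - c))]
  simp

/-- The one-dimensional long-stencil second difference, without its scaling factor,
is symmetric. -/
theorem sum_stencil_symm (m : ℕ) [NeZero m] (f g : ZMod m → ℝ) :
    ∑ i, (-f (i - 2) + 16 * f (i - 1) - 30 * f i + 16 * f (i + 1) - f (i + 2)) * g i
      = ∑ i, f i * (-g (i - 2) + 16 * g (i - 1) - 30 * g i + 16 * g (i + 1) - g (i + 2)) := by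
  have h1 := sum_shift_mul m f g 1
  have h2 := sum_shift_mul m f g 2
  have h3 := sum_shift_mul m f g (-1)
  have h4 := sum_shift_mul m f g (-2)
  simp only [← sub_eq_add_neg, sub_neg_eq_add] at h3 h4
  have hl : ∀ i, (-f (i - 2) + 16 * f (i - 1) - 30 * f i + 16 * f (i + 1) - f (i + 2)) * g i
      = -1 * (f (i - 2) * g i) + 16 * (f (i - 1) * g i) + -30 * (f i * g i)
        + 16 * (f (i + 1) * g i) + -1 * (f (i + 2) * g i) := fun i => by ring
  have hr : ∀ i, f i * (-g (i - 2) + 16 * g (i - 1) - 30 * g i + 16 * g (i + 1) - g (i + 2))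
      = -1 * (f i * g (i - 2)) + 16 * (f i * g (i - 1)) + -30 * (f i * g i)
        + 16 * (f i * g (i + 1)) + -1 * (f i * g (i + 2)) := fun i => by ring
  simp only [hl, hr, sum_add_distrib, ← mul_sum, h1, h2, h3, h4]
  ring

/-- The one-dimensional long-stencil second difference is negative semidefinite. -/
theorem sum_mul_stencil_nonpos (m : ℕ) [NeZero m] (f : ZMod m → ℝ) :
    ∑ i, f i * (-f (i - 2) + 16 * f (i - 1) - 30 * f i + 16 * f (i + 1) - f (i + 2)) ≤ 0 := by
  have h1 := sum_shift_mul m f f 1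
  have h2 := sum_shift_mul m f f 2
  have h3 := Equiv.sum_comp (Equiv.addRight (1 : ZMod m)) (fun i => f i * f i)
  have h4 := Equiv.sum_comp (Equiv.subRight (1 : ZMod m)) (fun i => f i * f i)
  have h5 := Equiv.sum_comp (Equiv.subRight (1 : ZMod m)) (fun i => f (i + 2) * f i)
  simp only [Equiv.coe_addRight, Equiv.subRight_apply] at h3 h4 h5
  have e : ∀ i : ZMod m, i - 1 + 2 = i + 1 := fun i => by ring
  simp only [e] at h5
  have hpos : 0 ≤ ∑ i, (12 * (f (i + 1) - f i) ^ 2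
      + (f (i - 1) - 2 * f i + f (i + 1)) ^ 2) := sum_nonneg fun i _ => by positivity
  have hl : ∀ i, f i * (-f (i - 2) + 16 * f (i - 1) - 30 * f i + 16 * f (i + 1) - f (i + 2))
      = -1 * (f i * f (i - 2)) + 16 * (f i * f (i - 1)) + -30 * (f i * f i)
        + 16 * (f (i + 1) * f i) + -1 * (f (i + 2) * f i) := fun i => by ring
  have hr : ∀ i, 12 * (f (i + 1) - f i) ^ 2 + (f (i - 1) - 2 * f i + f (i + 1)) ^ 2
      = 13 * (f (i + 1) * f (i + 1)) + 16 * (f i * f i) + -28 * (f (i + 1) * f i)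
        + f (i - 1) * f (i - 1) + -4 * (f i * f (i - 1)) + 2 * (f (i + 1) * f (i - 1)) :=
    fun i => by ring
  simp only [hr, sum_add_distrib, ← mul_sum] at hpos
  simp only [hl, sum_add_distrib, ← mul_sum]
  linarith

theorem sum_lap4_mul (m : ℕ) [NeZero m] (h : ℝ) (f g : ZMod m → ZMod m → ℝ) :
    ∑ i, ∑ j, lap4 m h f i j * g i j = ∑ i, ∑ j, f i j * lap4 m h g i j := by
  simp only [lap4, add_mul, mul_add, sum_add_distrib, div_mul_eq_mul_div, mul_div_assoc',
    ← sum_div]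
  congr 2
  · rw [sum_comm, sum_comm (f := fun i j => f i j * _)]
    exact sum_congr rfl fun j _ => sum_stencil_symm m (fun i => f i j) (fun i => g i j)
  · exact sum_congr rfl fun i _ => sum_stencil_symm m (f i) (g i)

theorem sum_mul_lap4_nonpos (m : ℕ) [NeZero m] (h : ℝ) (f : ZMod m → ZMod m → ℝ) :
    ∑ i, ∑ j, f i j * lap4 m h f i j ≤ 0 := by
  simp only [lap4, mul_add, sum_add_distrib, mul_div_assoc', ← sum_div]
  refine add_nonpos (div_nonpos_of_nonpos_of_nonneg ?_ (by positivity))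
    (div_nonpos_of_nonpos_of_nonneg ?_ (by positivity))
  · rw [sum_comm]
    exact sum_nonpos fun j _ => sum_mul_stencil_nonpos m (fun i => f i j)
  · exact sum_nonpos fun i _ => sum_mul_stencil_nonpos m (f i)

theorem lap4_add (m : ℕ) (h : ℝ) (f g : ZMod m → ZMod m → ℝ) (i j : ZMod m) :
    lap4 m h (fun a b => f a b + g a b) i j = lap4 m h f i j + lap4 m h g i j := by
  simp only [lap4]; ring

theorem lap4_sub (m : ℕ) (h : ℝ) (f g : ZMod m → ZMod m → ℝ) (i j : ZMod m) :
    lap4 m h (fun a b => f a b - g a b) i j = lap4 m h f i j - lap4 m h g i j := by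
  simp only [lap4]; ring

theorem lap4_const_mul (m : ℕ) (h c : ℝ) (f : ZMod m → ZMod m → ℝ) (i j : ZMod m) :
    lap4 m h (fun a b => c * f a b) i j = c * lap4 m h f i j := by
  simp only [lap4]; ring

/-- Energy stability of the BDF2 fourth-order finite difference scheme for the
Cahn-Hilliard equation, provided `A ≥ 1/16`: the modified energy
`E_h(φ⁺) + (1/(4τ))‖φ⁺ − φ‖₋₁ₕ² + (1/2)‖φ⁺ − φ‖₂²` does not increase. -/
theorem chScheme_energy_stability (L : ℝ) (hL : 0 < L) (m : ℕ) [NeZero m]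
    (h : ℝ) (hh : h = L / m) (ε τ A : ℝ) (hε : 0 < ε) (hτ : 0 < τ) (hA : 1 / 16 ≤ A)
    (φp φ φm : ZMod m → ZMod m → ℝ)
    (havg1 : gridAvg m φp = gridAvg m φ) (havg2 : gridAvg m φ = gridAvg m φm)
    (hscheme : chScheme m h ε τ A φ φm φp)
    (ψp ψ : ZMod m → ZMod m → ℝ)
    (hψp_avg : gridAvg m ψp = 0) (hψ_avg : gridAvg m ψ = 0)
    (hψp : ∀ i j : ZMod m, -(lap4 m h ψp i j) = φp i j - φ i j)
    (hψ : ∀ i j : ZMod m, -(lap4 m h ψ i j) = φ i j - φm i j) :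
    discEnergy m h L ε φp
        + 1 / (4 * τ) * gridInner m h (fun i j => φp i j - φ i j) ψp
        + 1 / 2 * (h ^ 2 * ∑ i : ZMod m, ∑ j : ZMod m, (φp i j - φ i j) ^ 2)
      ≤ discEnergy m h L ε φ
          + 1 / (4 * τ) * gridInner m h (fun i j => φ i j - φm i j) ψ
          + 1 / 2 * (h ^ 2 * ∑ i : ZMod m, ∑ j : ZMod m, (φ i j - φm i j) ^ 2) := by
  have hp : ∀ i j, lap4 m h ψp i j = -(φp i j - φ i j) := fun i j => by rw [← hψp, neg_neg]
  have h0 : ∀ i j, lap4 m h ψ i j = -(φ i j - φm i j) := fun i j => by rw [← hψ, neg_neg]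
  have hzero : ∑ i, ∑ j, (φp i j - φ i j) * ((φp i j ^ 3 - 2 * φ i j + φm i j
      - ε ^ 2 * lap4 m h φp i j - A * τ * (lap4 m h φp i j - lap4 m h φ i j))
      + (3 / (2 * τ) * ψp i j - 1 / (2 * τ) * ψ i j)) = 0 := by
    have key := sum_lap4_mul m h ψp (fun i j => (φp i j ^ 3 - 2 * φ i j + φm i j
      - ε ^ 2 * lap4 m h φp i j - A * τ * lap4 m h (fun c d => φp c d - φ c d) i j)
      + (3 / (2 * τ) * ψp i j - 1 / (2 * τ) * ψ i j))
    have hM : ∀ i j, lap4 m h (fun i j => (φp i j ^ 3 - 2 * φ i j + φm i j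
      - ε ^ 2 * lap4 m h φp i j - A * τ * lap4 m h (fun c d => φp c d - φ c d) i j)
      + (3 / (2 * τ) * ψp i j - 1 / (2 * τ) * ψ i j)) i j = 0 := fun i j => by
      rw [lap4_add, ← hscheme i j, lap4_sub, lap4_const_mul, lap4_const_mul, hp, h0]
      field_simp
      ring
    simp only [hM, mul_zero, sum_const_zero] at key
    simp only [hp, lap4_sub, neg_mul, sum_neg_distrib, neg_eq_zero] at key
    exact key
  have hcross : ∑ i, ∑ j, (φp i j - φ i j) * ψ i j = ∑ i, ∑ j, ψp i j * (φ i j - φm i j) := by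
    have key := sum_lap4_mul m h ψp ψ
    simpa only [hp, h0, neg_mul, mul_neg, sum_neg_distrib, neg_inj] using key
  have hsymm := sum_lap4_mul m h φ φp
  have hdual : ∑ i, ∑ j, ψp i j * (lap4 m h φp i j - lap4 m h φ i j)
      = -∑ i, ∑ j, (φp i j - φ i j) ^ 2 := by
    have key := sum_lap4_mul m h ψp (fun i j => φp i j - φ i j)
    simp only [hp, lap4_sub, neg_mul, sum_neg_distrib, ← sq] at key
    exact key.symm
  have hpsi : ∑ i, ∑ j, (ψp i j - ψ i j) * (-(φp i j - φ i j) - -(φ i j - φm i j)) ≤ 0 := by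
    have key := sum_mul_lap4_nonpos m h (fun i j => ψp i j - ψ i j)
    simpa only [lap4_sub, hp, h0] using key
  have hmix : ∑ i, ∑ j, (ψp i j - τ / 4 * (φp i j - φ i j)) * (-(φp i j - φ i j)
      - τ / 4 * (lap4 m h φp i j - lap4 m h φ i j)) ≤ 0 := by
    have key := sum_mul_lap4_nonpos m h (fun i j => ψp i j - τ / 4 * (φp i j - φ i j))
    simpa only [lap4_sub, lap4_const_mul, hp] using key
  have hd : ∑ i, ∑ j, (φp i j - φ i j) * (lap4 m h φp i j - lap4 m h φ i j) ≤ 0 := by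
    have key := sum_mul_lap4_nonpos m h (fun i j => φp i j - φ i j)
    simpa only [lap4_sub] using key
  have hsq : 0 ≤ ∑ i, ∑ j, ((φp i j - φ i j) ^ 2 * ((φp i j + φ i j) ^ 2 + 2 * φp i j ^ 2) / 4
      + (φp i j - 2 * φ i j + φm i j) ^ 2 / 2) :=
    sum_nonneg fun i _ => sum_nonneg fun j _ => by positivity
  have hpoint : ∀ i j,
      1 / 4 * φ i j ^ 4 + -(1 / 4) * φp i j ^ 4 + -(1 / 2) * φ i j ^ 2 + 1 / 2 * φp i j ^ 2
        + ε ^ 2 / 2 * (φ i j * -lap4 m h φ i j) + -(ε ^ 2 / 2) * (φp i j * -lap4 m h φp i j)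
        + 1 / (4 * τ) * ((φ i j - φm i j) * ψ i j)
        + -(1 / (4 * τ)) * ((φp i j - φ i j) * ψp i j)
        + 1 / 2 * (φ i j - φm i j) ^ 2 + -(1 / 2) * (φp i j - φ i j) ^ 2
      = -1 * ((φp i j - φ i j) * ((φp i j ^ 3 - 2 * φ i j + φm i j
          - ε ^ 2 * lap4 m h φp i j - A * τ * (lap4 m h φp i j - lap4 m h φ i j))
          + (3 / (2 * τ) * ψp i j - 1 / (2 * τ) * ψ i j)))
        + ((φp i j - φ i j) ^ 2 * ((φp i j + φ i j) ^ 2 + 2 * φp i j ^ 2) / 4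
          + (φp i j - 2 * φ i j + φm i j) ^ 2 / 2)
        + -(1 / (4 * τ)) * ((ψp i j - ψ i j) * (-(φp i j - φ i j) - -(φ i j - φm i j)))
        + -(1 / τ) * ((ψp i j - τ / 4 * (φp i j - φ i j)) * (-(φp i j - φ i j)
          - τ / 4 * (lap4 m h φp i j - lap4 m h φ i j)))
        + -((A - 1 / 16) * τ + ε ^ 2 / 2)
          * ((φp i j - φ i j) * (lap4 m h φp i j - lap4 m h φ i j))
        + -(1 / (4 * τ)) * ((φp i j - φ i j) * ψ i j)
        + 1 / (4 * τ) * (ψp i j * (φ i j - φm i j))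
        + -(1 / 4) * (ψp i j * (lap4 m h φp i j - lap4 m h φ i j))
        + -(1 / 4) * (φp i j - φ i j) ^ 2
        + -(ε ^ 2 / 2) * (lap4 m h φ i j * φp i j)
        + ε ^ 2 / 2 * (φ i j * lap4 m h φp i j) := fun i j => by
    field_simp
    ring
  have hsum := sum_congr rfl fun i (_ : i ∈ (univ : Finset (ZMod m))) =>
    sum_congr rfl fun j (_ : j ∈ (univ : Finset (ZMod m))) => hpoint i j
  rw [← sub_nonneg]
  have hτ1 : 0 ≤ 1 / (4 * τ) := by positivity
  have hτ2 : 0 ≤ 1 / τ := by positivity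
  have hA' : 0 ≤ (A - 1 / 16) * τ + ε ^ 2 / 2 := by
    have : 0 ≤ (A - 1 / 16) * τ := mul_nonneg (by linarith) hτ.le
    positivity
  have t1 := mul_nonpos_of_nonneg_of_nonpos hτ1 hpsi
  have t2 := mul_nonpos_of_nonneg_of_nonpos hτ2 hmix
  have t3 := mul_nonpos_of_nonneg_of_nonpos hA' hd
  have hnonneg : 0 ≤ ∑ i, ∑ j,
      (1 / 4 * φ i j ^ 4 + -(1 / 4) * φp i j ^ 4 + -(1 / 2) * φ i j ^ 2 + 1 / 2 * φp i j ^ 2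
        + ε ^ 2 / 2 * (φ i j * -lap4 m h φ i j) + -(ε ^ 2 / 2) * (φp i j * -lap4 m h φp i j)
        + 1 / (4 * τ) * ((φ i j - φm i j) * ψ i j)
        + -(1 / (4 * τ)) * ((φp i j - φ i j) * ψp i j)
        + 1 / 2 * (φ i j - φm i j) ^ 2 + -(1 / 2) * (φp i j - φ i j) ^ 2) := by
    rw [hsum]
    simp only [sum_add_distrib, ← mul_sum] at hsq ⊢
    rw [hzero, hcross, hdual, hsymm]
    linarith
  refine (mul_nonneg (sq_nonneg h) hnonneg).trans_eq ?_
  simp only [sum_add_distrib, ← mul_sum]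
  simp only [discEnergy, gridInner, sq_abs, Even.pow_abs (by decide : Even 4)]
  ring
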